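/- arXiv:1909.04115 — 2 statements merged into one kernel-verified Lean document; each statement's English description precedes it below -/
import Mathlib

section
/- For any two Markov kernels p and p̂ from S × A to S, the γ-discounted state–action distributions satisfy ‖δ_μ^{π,p} − δ_μ^{π,p̂}‖_TV ≤ (γ/(1−γ)) · ∫ ‖p(·|s,a) − p̂(·|s,a)‖_TV dδ_μ^{π,p}(s,a). -/
open MeasureTheory ProbabilityTheory
open scoped ENNReal

noncomputable section

variable {S A : Type*} [MeasurableSpace S] [MeasurableSpace A]

/-- The step kernel `K^{π,p}` on `S × A`: from `(s,a)`, draw `s' ~ p(·|s,a)` and then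
`a' ~ π(·|s')`. -/
def stepK (p : Kernel (S × A) S) (π : Kernel S A) : Kernel (S × A) (S × A) :=
  p ⊗ₖ Kernel.prodMkLeft (S × A) π

/-- `δ_t[m₀]`: the law of the time-`t` state–action pair of the Markov chain with initial
distribution `m₀` and transition kernel `K^{π,p}`. -/
def stepIter (p : Kernel (S × A) S) (π : Kernel S A) (m₀ : Measure (S × A)) :
    ℕ → Measure (S × A)
  | 0 => m₀
  | t + 1 => (stepIter p π m₀ t).bind (fun x => stepK p π x)

/-- The `γ`-discounted state–action distribution `δ^{π,p}[m₀] = (1-γ) ∑ₜ γ^t δ_t[m₀]`. -/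
def disc (p : Kernel (S × A) S) (π : Kernel S A) (γ : ℝ) (m₀ : Measure (S × A)) :
    Measure (S × A) :=
  Measure.sum fun t => ENNReal.ofReal ((1 - γ) * γ ^ t) • stepIter p π m₀ t

/-- The total-variation norm `‖m − m'‖_TV` of the difference of two (finite) measures.
For finite measures this supremum equals `|m − m'|(univ)`, i.e. the total variation of
the signed measure `m − m'`. -/
def tvDist {X : Type*} [MeasurableSpace X] (m m' : Measure X) : ℝ≥0∞ :=
  ⨆ (B : Set X) (_ : MeasurableSet B), ((m B - m' B) + (m' Bᶜ - m Bᶜ))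

lemma tvDist_of_isProbabilityMeasure {X : Type*} [MeasurableSpace X] (m m' : Measure X)
    [IsProbabilityMeasure m] [IsProbabilityMeasure m'] :
    tvDist m m' = ⨆ (B : Set X) (_ : MeasurableSet B), 2 * (m B - m' B) := by
  refine iSup_congr fun B => iSup_congr fun hB => ?_
  rw [prob_compl_eq_one_sub hB, prob_compl_eq_one_sub hB, two_mul]
  congr 1
  rw [tsub_tsub, add_comm, ← tsub_tsub, ENNReal.sub_sub_cancel ENNReal.one_ne_top prob_le_one]

/-- Test functions with values in `[0,1]` see at most half of the total variation. -/
lemma two_mul_lintegral_sub_le_tvDist {X : Type*} [MeasurableSpace X] (m m' : Measure X)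
    [IsProbabilityMeasure m] [IsProbabilityMeasure m'] {g : X → ℝ≥0∞}
    (hg1 : ∀ x, g x ≤ 1) :
    2 * (∫⁻ x, g x ∂m - ∫⁻ x, g x ∂m') ≤ tvDist m m' := by
  obtain ⟨s, hs, hpos, hneg⟩ := hahn_decomposition m m'
  rw [tvDist_of_isProbabilityMeasure]
  refine le_trans ?_ (le_iSup₂ s hs)
  refine mul_le_mul_right ?_ 2
  rw [tsub_le_iff_right, ← lintegral_add_compl (μ := m) g hs, ← lintegral_add_compl (μ := m') g hs]
  have hle : m'.restrict s ≤ m.restrict s := Measure.le_iff.2 fun t ht => by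
    rw [Measure.restrict_apply ht, Measure.restrict_apply ht]
    exact hpos _ (ht.inter hs) Set.inter_subset_right
  have hle' : m.restrict sᶜ ≤ m'.restrict sᶜ := Measure.le_iff.2 fun t ht => by
    rw [Measure.restrict_apply ht, Measure.restrict_apply ht]
    exact hneg _ (ht.inter hs.compl) Set.inter_subset_right
  have h1 : ∫⁻ x in s, g x ∂m ≤ (m s - m' s) + ∫⁻ x in s, g x ∂m' := by
    rw [← Measure.sub_add_cancel_of_le hle, lintegral_add_measure]
    gcongr
    calc ∫⁻ x, g x ∂(m.restrict s - m'.restrict s)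
        ≤ ∫⁻ _, 1 ∂(m.restrict s - m'.restrict s) := lintegral_mono hg1
      _ = m s - m' s := by
        rw [lintegral_one, Measure.sub_apply MeasurableSet.univ hle,
          Measure.restrict_apply_univ, Measure.restrict_apply_univ]
  rw [← add_assoc]
  exact add_le_add h1 (lintegral_mono' hle' le_rfl)

instance (p : Kernel (S × A) S) [IsMarkovKernel p] (π : Kernel S A) [IsMarkovKernel π] :
    IsMarkovKernel (stepK p π) := by
  unfold stepK; infer_instance

lemma lintegral_stepK (p : Kernel (S × A) S) [IsMarkovKernel p] (π : Kernel S A)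
    [IsMarkovKernel π] (x : S × A) {f : S × A → ℝ≥0∞} (hf : Measurable f) :
    ∫⁻ z, f z ∂(stepK p π x) = ∫⁻ y, ∫⁻ a, f (y, a) ∂(π y) ∂(p x) := by
  rw [stepK, Kernel.lintegral_compProd _ _ _ hf]
  rfl

lemma lintegral_stepIter_succ (p : Kernel (S × A) S) (π : Kernel S A) (m₀ : Measure (S × A))
    (t : ℕ) {f : S × A → ℝ≥0∞} (hf : Measurable f) :
    ∫⁻ z, f z ∂(stepIter p π m₀ (t + 1)) =
      ∫⁻ x, ∫⁻ z, f z ∂(stepK p π x) ∂(stepIter p π m₀ t) :=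
  Measure.lintegral_bind (stepK p π).measurable.aemeasurable hf.aemeasurable

instance (p : Kernel (S × A) S) [IsMarkovKernel p] (π : Kernel S A) [IsMarkovKernel π]
    (m₀ : Measure (S × A)) [IsProbabilityMeasure m₀] (t : ℕ) :
    IsProbabilityMeasure (stepIter p π m₀ t) := by
  induction t with
  | zero => assumption
  | succ t ih =>
    constructor
    rw [← lintegral_one, lintegral_stepIter_succ p π m₀ t measurable_const]
    simp

lemma tsum_discount {γ : ℝ} (hγ0 : 0 ≤ γ) (hγ1 : γ < 1) :
    ∑' t : ℕ, ENNReal.ofReal ((1 - γ) * γ ^ t) = 1 := by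
  rw [← ENNReal.ofReal_tsum_of_nonneg
    (fun t => mul_nonneg (sub_nonneg.2 hγ1.le) (pow_nonneg hγ0 t))
    ((summable_geometric_of_lt_one hγ0 hγ1).mul_left _), tsum_mul_left,
    tsum_geometric_of_lt_one hγ0 hγ1, mul_inv_cancel₀ (sub_pos.2 hγ1).ne', ENNReal.ofReal_one]

lemma discount_succ {γ : ℝ} (hγ0 : 0 ≤ γ) (t : ℕ) :
    ENNReal.ofReal ((1 - γ) * γ ^ (t + 1)) =
      ENNReal.ofReal γ * ENNReal.ofReal ((1 - γ) * γ ^ t) := by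
  rw [← ENNReal.ofReal_mul hγ0]
  congr 1
  ring

lemma lintegral_disc (p : Kernel (S × A) S) (π : Kernel S A) (γ : ℝ) (m₀ : Measure (S × A))
    (f : S × A → ℝ≥0∞) :
    ∫⁻ z, f z ∂(disc p π γ m₀) =
      ∑' t, ENNReal.ofReal ((1 - γ) * γ ^ t) * ∫⁻ z, f z ∂(stepIter p π m₀ t) := by
  simp [disc, lintegral_sum_measure, lintegral_smul_measure]

lemma isProbabilityMeasure_disc (p : Kernel (S × A) S) [IsMarkovKernel p] (π : Kernel S A)
    [IsMarkovKernel π] {γ : ℝ} (hγ0 : 0 ≤ γ) (hγ1 : γ < 1) (m₀ : Measure (S × A))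
    [IsProbabilityMeasure m₀] : IsProbabilityMeasure (disc p π γ m₀) := by
  constructor
  rw [← lintegral_one, lintegral_disc]
  simp [tsum_discount hγ0 hγ1]

/-- The stationarity equation `δ = (1-γ) m₀ + γ δ K`, tested against `f`. -/
lemma lintegral_disc_eq (p : Kernel (S × A) S) (π : Kernel S A) {γ : ℝ} (hγ0 : 0 ≤ γ)
    (m₀ : Measure (S × A)) {f : S × A → ℝ≥0∞} (hf : Measurable f) :
    ∫⁻ z, f z ∂(disc p π γ m₀) =
      ENNReal.ofReal (1 - γ) * ∫⁻ z, f z ∂m₀ +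
        ENNReal.ofReal γ * ∫⁻ x, ∫⁻ z, f z ∂(stepK p π x) ∂(disc p π γ m₀) := by
  rw [lintegral_disc, lintegral_disc, tsum_eq_zero_add' ENNReal.summable, ← ENNReal.tsum_mul_left]
  simp only [discount_succ hγ0, lintegral_stepIter_succ p π m₀ _ hf, mul_assoc, pow_zero, mul_one]
  rfl

/-- The expectation of `f` after `t` steps, as a function of the starting point. -/
def valueIter (p : Kernel (S × A) S) (π : Kernel S A) (f : S × A → ℝ≥0∞) :
    ℕ → S × A → ℝ≥0∞
  | 0 => f
  | t + 1 => fun x => ∫⁻ z, valueIter p π f t z ∂(stepK p π x)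

lemma measurable_valueIter (p : Kernel (S × A) S) (π : Kernel S A) {f : S × A → ℝ≥0∞}
    (hf : Measurable f) (t : ℕ) : Measurable (valueIter p π f t) := by
  induction t with
  | zero => exact hf
  | succ t ih => exact ih.lintegral_kernel

lemma valueIter_le_one (p : Kernel (S × A) S) [IsMarkovKernel p] (π : Kernel S A)
    [IsMarkovKernel π] {f : S × A → ℝ≥0∞} (hf : ∀ x, f x ≤ 1) (t : ℕ) (x : S × A) :
    valueIter p π f t x ≤ 1 := by
  induction t generalizing x with
  | zero => exact hf x
  | succ t ih => exact (lintegral_mono ih).trans (by simp)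

lemma lintegral_valueIter (p : Kernel (S × A) S) (π : Kernel S A) (m₀ : Measure (S × A))
    {f : S × A → ℝ≥0∞} (hf : Measurable f) (s t : ℕ) :
    ∫⁻ z, valueIter p π f s z ∂(stepIter p π m₀ t) =
      ∫⁻ z, valueIter p π f (s + t) z ∂m₀ := by
  induction t generalizing s with
  | zero => rfl
  | succ t ih =>
    rw [lintegral_stepIter_succ p π m₀ t (measurable_valueIter p π hf s), ← add_assoc,
      add_right_comm, ← ih (s + 1)]
    rfl

/-- The normalized discounted value function of the reward `f`. -/
def discValue (p : Kernel (S × A) S) (π : Kernel S A) (γ : ℝ) (f : S × A → ℝ≥0∞)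
    (x : S × A) : ℝ≥0∞ :=
  ∑' t, ENNReal.ofReal ((1 - γ) * γ ^ t) * valueIter p π f t x

lemma measurable_discValue (p : Kernel (S × A) S) (π : Kernel S A) (γ : ℝ)
    {f : S × A → ℝ≥0∞} (hf : Measurable f) : Measurable (discValue p π γ f) :=
  Measurable.tsum fun t => (measurable_valueIter p π hf t).const_mul _

lemma discValue_le_one (p : Kernel (S × A) S) [IsMarkovKernel p] (π : Kernel S A)
    [IsMarkovKernel π] {γ : ℝ} (hγ0 : 0 ≤ γ) (hγ1 : γ < 1) {f : S × A → ℝ≥0∞}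
    (hf : ∀ x, f x ≤ 1) (x : S × A) : discValue p π γ f x ≤ 1 := by
  rw [← tsum_discount hγ0 hγ1]
  exact ENNReal.tsum_le_tsum fun t => mul_le_of_le_one_right' (valueIter_le_one p π hf t x)

lemma lintegral_discValue (p : Kernel (S × A) S) (π : Kernel S A) (γ : ℝ) (m : Measure (S × A))
    {f : S × A → ℝ≥0∞} (hf : Measurable f) :
    ∫⁻ x, discValue p π γ f x ∂m =
      ∑' t, ENNReal.ofReal ((1 - γ) * γ ^ t) * ∫⁻ x, valueIter p π f t x ∂m := by
  unfold discValue
  rw [lintegral_tsum fun t => ((measurable_valueIter p π hf t).const_mul _).aemeasurable]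
  exact tsum_congr fun t => lintegral_const_mul _ (measurable_valueIter p π hf t)

lemma lintegral_discValue_eq_lintegral_disc (p : Kernel (S × A) S) (π : Kernel S A) (γ : ℝ)
    (m₀ : Measure (S × A)) {f : S × A → ℝ≥0∞} (hf : Measurable f) :
    ∫⁻ x, discValue p π γ f x ∂m₀ = ∫⁻ x, f x ∂(disc p π γ m₀) := by
  rw [lintegral_discValue p π γ m₀ hf, lintegral_disc]
  refine tsum_congr fun t => ?_
  have h := lintegral_valueIter p π m₀ hf 0 t
  rw [zero_add] at h
  rw [← h]
  rfl

/-- The Bellman equation for the value function. -/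
lemma discValue_eq (p : Kernel (S × A) S) (π : Kernel S A) {γ : ℝ} (hγ0 : 0 ≤ γ)
    {f : S × A → ℝ≥0∞} (hf : Measurable f) (x : S × A) :
    discValue p π γ f x = ENNReal.ofReal (1 - γ) * f x +
      ENNReal.ofReal γ * ∫⁻ z, discValue p π γ f z ∂(stepK p π x) := by
  rw [lintegral_discValue p π γ _ hf, discValue, tsum_eq_zero_add' ENNReal.summable,
    ← ENNReal.tsum_mul_left]
  simp only [discount_succ hγ0, mul_assoc, pow_zero, mul_one, valueIter]

/-- Lemma 3: `‖δ_μ^{π,p} − δ_μ^{π,p̂}‖_TV ≤ (γ/(1−γ)) ∫ ‖p(·|s,a) − p̂(·|s,a)‖_TV dδ_μ^{π,p}`. -/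
theorem tv_disc_bound
    (p phat : Kernel (S × A) S) [IsMarkovKernel p] [IsMarkovKernel phat]
    (π : Kernel S A) [IsMarkovKernel π]
    (μ : Measure S) [IsProbabilityMeasure μ]
    (γ : ℝ) (hγ0 : 0 ≤ γ) (hγ1 : γ < 1) :
    tvDist (disc p π γ (μ ⊗ₘ π)) (disc phat π γ (μ ⊗ₘ π)) ≤
      ENNReal.ofReal (γ / (1 - γ)) *
        ∫⁻ x, tvDist (p x) (phat x) ∂(disc p π γ (μ ⊗ₘ π)) := by
  have := isProbabilityMeasure_disc p π hγ0 hγ1 (μ ⊗ₘ π)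
  have := isProbabilityMeasure_disc phat π hγ0 hγ1 (μ ⊗ₘ π)
  rw [tvDist_of_isProbabilityMeasure]
  refine iSup₂_le fun B hB => ?_
  set δ := disc p π γ (μ ⊗ₘ π)
  have hf : Measurable (B.indicator (1 : S × A → ℝ≥0∞)) := measurable_one.indicator hB
  have hf1 : ∀ x, B.indicator (1 : S × A → ℝ≥0∞) x ≤ 1 :=
    fun x => Set.indicator_le_self' (fun _ _ => zero_le) x
  set h := discValue phat π γ (B.indicator 1)
  have hh : Measurable h := measurable_discValue phat π γ hf
  have hh1 : ∀ x, h x ≤ 1 := discValue_le_one phat π hγ0 hγ1 hf1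
  set D : S × A → ℝ≥0∞ := fun x => ∫⁻ z, h z ∂(stepK p π x) - ∫⁻ z, h z ∂(stepK phat π x)
  have hK : Measurable fun x => ∫⁻ z, h z ∂(stepK phat π x) := hh.lintegral_kernel
  have hD : Measurable D := hh.lintegral_kernel.sub hK
  have hD_le : ∀ x, 2 * D x ≤ tvDist (p x) (phat x) := fun x => by
    simp only [D, lintegral_stepK _ π x hh]
    exact two_mul_lintegral_sub_le_tvDist _ _
      fun y => (lintegral_mono fun a => hh1 (y, a)).trans (by simp)
  have h_fin : ENNReal.ofReal γ * ∫⁻ x, ∫⁻ z, h z ∂(stepK phat π x) ∂δ ≠ ∞ := by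
    refine ENNReal.mul_ne_top ENNReal.ofReal_ne_top (ne_top_of_le_ne_top ENNReal.one_ne_top ?_)
    refine (lintegral_mono fun x => (lintegral_mono hh1).trans ?_).trans (b := ∫⁻ _, 1 ∂δ) ?_
    · simp
    · simp
  have h_bellman : ∫⁻ x, h x ∂δ = ENNReal.ofReal (1 - γ) * δ B +
      ENNReal.ofReal γ * ∫⁻ x, ∫⁻ z, h z ∂(stepK phat π x) ∂δ := by
    rw [← lintegral_indicator_one hB, ← lintegral_const_mul _ hf, ← lintegral_const_mul _ hK,
      ← lintegral_add_left (hf.const_mul _)]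
    exact lintegral_congr fun x => discValue_eq phat π hγ0 hf x
  have h_stat := lintegral_disc_eq p π hγ0 (μ ⊗ₘ π) hh
  rw [h_bellman, lintegral_discValue_eq_lintegral_disc phat π γ _ hf, lintegral_indicator_one hB] at h_stat
  have h_step : ∫⁻ x, ∫⁻ z, h z ∂(stepK p π x) ∂δ ≤
      ∫⁻ x, D x ∂δ + ∫⁻ x, ∫⁻ z, h z ∂(stepK phat π x) ∂δ := by
    rw [← lintegral_add_left hD]
    exact lintegral_mono fun x => le_tsub_add
  have h_main : ENNReal.ofReal (1 - γ) * δ B ≤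
      ENNReal.ofReal (1 - γ) * disc phat π γ (μ ⊗ₘ π) B + ENNReal.ofReal γ * ∫⁻ x, D x ∂δ := by
    refine (ENNReal.add_le_add_iff_right h_fin).1 ?_
    rw [h_stat, add_assoc, ← mul_add]
    gcongr
  have hγ : ENNReal.ofReal (1 - γ) ≠ 0 := (ENNReal.ofReal_pos.2 (sub_pos.2 hγ1)).ne'
  have h_sub : δ B - disc phat π γ (μ ⊗ₘ π) B ≤
      ENNReal.ofReal (γ / (1 - γ)) * ∫⁻ x, D x ∂δ := by
    rw [tsub_le_iff_left, ← ENNReal.mul_le_mul_iff_right hγ ENNReal.ofReal_ne_top, mul_add,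
      ← mul_assoc, ← ENNReal.ofReal_mul (sub_nonneg.2 hγ1.le),
      mul_div_cancel₀ _ (sub_pos.2 hγ1).ne']
    exact h_main
  calc 2 * (δ B - disc phat π γ (μ ⊗ₘ π) B)
      ≤ 2 * (ENNReal.ofReal (γ / (1 - γ)) * ∫⁻ x, D x ∂δ) := by gcongr
    _ = ENNReal.ofReal (γ / (1 - γ)) * ∫⁻ x, 2 * D x ∂δ := by
      rw [lintegral_const_mul _ hD, mul_left_comm]
    _ ≤ _ := by
      gcongr with x
      exact hD_le x

end
end

section
/- Assume sup_{s∈S} ∫ (π(a|s)/π_b(a|s))² π_b(da|s) ≤ χ₁ with γ·χ₁ < 1, sup_{s∈S} ∫ (π(a|s)/π_b(a|s))² ‖g(s,a)‖_q² π_b(da|s) ≤ χ₂, and sup_{(s,a)∈S×A} ∫ (log p̄(s′|s,a))² p(ds′|s,a) ≤ χ₃, where p̄ is a Markov kernel from S × A to S with jointly measurable positive conditional density p̄(s′|s,a) with respect to a σ-finite reference measure on S. Then E_{τ∼ζ_μ^{π_b,p}}[ ( Σ_{t≥0} γ^t ρ_{π/π_b}(τ_{0:t}) ( Σ_{l=0}^t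 ‖g(s_l,a_l)‖_q ) log p̄(s_{t+1}|s_t,a_t) )² ] ≤ χ₃·χ₂·(1+γχ₁) / ( (1−γ)·(1−γχ₁)³ ). -/
open MeasureTheory ProbabilityTheory
open scoped ENNReal

noncomputable section

variable {S A : Type*} [MeasurableSpace S] [MeasurableSpace A]

/-- The law of the length-`(n+1)` prefix of the Markov chain on `X` with initial
distribution `m₀` and transition kernel `K` (the finite-dimensional distributions of the
Ionescu–Tulcea trajectory measure). -/
def prefixLaw {X : Type*} [MeasurableSpace X] (K : Kernel X X) (m₀ : Measure X) :
    (n : ℕ) → Measure (Fin (n + 1) → X)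
  | 0 => m₀.map (fun x _ => x)
  | n + 1 =>
      ((prefixLaw K m₀ n) ⊗ₘ (K.comap (fun v => v (Fin.last n)) (measurable_pi_apply _))).map
        (fun va => Fin.snoc va.1 va.2)

/-- `ζ` is the trajectory law (Ionescu–Tulcea) of the Markov chain with initial
distribution `m₀` and transition kernel `K`: its finite-dimensional prefix marginals are
given by `prefixLaw`. -/
def IsTrajLaw {X : Type*} [MeasurableSpace X] (K : Kernel X X) (m₀ : Measure X)
    (ζ : Measure (ℕ → X)) : Prop :=
  IsProbabilityMeasure ζ ∧
    ∀ n, ζ.map (fun τ => (fun i : Fin (n + 1) => τ i)) = prefixLaw K m₀ n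
/-- The ℓ^q norm on ℝ^d. -/
def lqNorm (q : ℝ≥0∞) [Fact (1 ≤ q)] {d : ℕ} (v : Fin d → ℝ) : ℝ :=
  ‖(WithLp.equiv q (Fin d → ℝ)).symm v‖

/-- Jensen's inequality for a geometrically weighted series. -/
lemma ofReal_tsum_geometric_mul_sq_le {γ : ℝ} (hγ0 : 0 ≤ γ) (hγ1 : γ < 1) (y : ℕ → ℝ) :
    ENNReal.ofReal ((∑' t, γ ^ t * y t) ^ 2) ≤
      ENNReal.ofReal (1 - γ)⁻¹ * ∑' t, ENNReal.ofReal (γ ^ t * y t ^ 2) := by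
  by_cases hs : Summable fun t => γ ^ t * y t
  · have hlim := (ENNReal.continuous_ofReal.tendsto _).comp (hs.hasSum.tendsto_sum_nat.pow 2)
    refine le_of_tendsto' hlim fun n => ?_
    have hcs : (∑ t ∈ Finset.range n, γ ^ t * y t) ^ 2 ≤
        (∑ t ∈ Finset.range n, γ ^ t) * ∑ t ∈ Finset.range n, γ ^ t * y t ^ 2 :=
      Finset.sum_sq_le_sum_mul_sum_of_sq_le_mul _ (fun _ _ => by positivity)
        (fun _ _ => by positivity) (fun _ _ => le_of_eq (by ring))
    have hgeom : ∑ t ∈ Finset.range n, γ ^ t ≤ (1 - γ)⁻¹ := by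
      rw [← tsum_geometric_of_lt_one hγ0 hγ1]
      exact (summable_geometric_of_lt_one hγ0 hγ1).sum_le_tsum _ fun _ _ => by positivity
    have hnn : 0 ≤ (1 - γ)⁻¹ := inv_nonneg.2 (by linarith)
    calc ENNReal.ofReal ((∑ t ∈ Finset.range n, γ ^ t * y t) ^ 2)
        ≤ ENNReal.ofReal ((1 - γ)⁻¹ * ∑ t ∈ Finset.range n, γ ^ t * y t ^ 2) :=
          ENNReal.ofReal_le_ofReal (hcs.trans (mul_le_mul_of_nonneg_right hgeom
            (Finset.sum_nonneg fun _ _ => by positivity)))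
      _ = ENNReal.ofReal (1 - γ)⁻¹ *
            ∑ t ∈ Finset.range n, ENNReal.ofReal (γ ^ t * y t ^ 2) := by
          rw [ENNReal.ofReal_mul hnn, ENNReal.ofReal_sum_of_nonneg fun _ _ => by positivity]
      _ ≤ _ := by gcongr; exact ENNReal.sum_le_tsum _
  · simp [tsum_eq_zero_of_not_summable hs]

lemma hasSum_succ_sq_mul_geometric {x : ℝ} (hx0 : 0 ≤ x) (hx1 : x < 1) :
    HasSum (fun t : ℕ => ((t : ℝ) + 1) ^ 2 * x ^ t) ((1 + x) / (1 - x) ^ 3) := by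
  have hx : ‖x‖ < 1 := by rwa [Real.norm_of_nonneg hx0]
  have h := ((hasSum_choose_mul_geometric_of_norm_lt_one 2 hx).mul_left 2).sub
    (hasSum_choose_mul_geometric_of_norm_lt_one 1 hx)
  have hne : 1 - x ≠ 0 := by linarith
  have hsum : (1 + x) / (1 - x) ^ 3 = 2 * (1 / (1 - x) ^ (2 + 1)) - 1 / (1 - x) ^ (1 + 1) := by
    field_simp
    ring
  rw [hsum]
  refine h.congr_fun fun t => ?_
  rw [Nat.cast_choose_two, Nat.choose_one_right]
  push_cast
  ring

lemma measurable_lqNorm (q : ℝ≥0∞) [Fact (1 ≤ q)] {d : ℕ} :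
    Measurable fun v : Fin d → ℝ => lqNorm q v :=
  (continuous_norm.comp (PiLp.continuous_toLp q fun _ : Fin d => ℝ)).measurable

lemma measurable_finSnoc {X : Type*} [MeasurableSpace X] (n : ℕ) :
    Measurable fun va : (Fin n → X) × X => (Fin.snoc va.1 va.2 : Fin (n + 1) → X) := by
  refine measurable_pi_iff.2 fun i => ?_
  induction i using Fin.lastCases with
  | last => simpa using measurable_snd
  | cast j => simpa using measurable_fst.eval

instance {p : Kernel (S × A) S} [IsMarkovKernel p] {π : Kernel S A} [IsMarkovKernel π] :
    IsMarkovKernel (stepK p π) := by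
  unfold stepK; infer_instance

section Chain

variable {X : Type*} [MeasurableSpace X] {K : Kernel X X} {m₀ : Measure X}
  {ζ : Measure (ℕ → X)}

/-- Conditional bound for the transition at time `n`, integrated against a function of the past. -/
lemma IsTrajLaw.lintegral_prefix_mul_le [IsMarkovKernel K] (hζ : IsTrajLaw K m₀ ζ) (n : ℕ)
    {G : (Fin (n + 1) → X) → ℝ≥0∞} (hG : Measurable G) {f : X → X → ℝ≥0∞}
    (hf : Measurable (Function.uncurry f)) {c : ℝ≥0∞} (hc : ∀ x, ∫⁻ y, f x y ∂(K x) ≤ c) :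
    ∫⁻ τ, G (fun i => τ i) * f (τ n) (τ (n + 1)) ∂ζ ≤ c * ∫⁻ τ, G (fun i => τ i) ∂ζ := by
  have := hζ.1
  have hprefix : ∀ m, Measurable fun τ : ℕ → X => (fun i : Fin (m + 1) => τ i) := fun m =>
    measurable_pi_iff.2 fun i => measurable_pi_apply _
  have : IsProbabilityMeasure (prefixLaw K m₀ n) := by
    rw [← hζ.2 n]
    exact Measure.isProbabilityMeasure_map (hprefix n).aemeasurable
  have hH : Measurable fun v : Fin (n + 2) → X =>
      G (fun i => v i.castSucc) * f (v (Fin.last n).castSucc) (v (Fin.last (n + 1))) :=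
    (hG.comp (measurable_pi_iff.2 fun i => measurable_pi_apply _)).mul
      (hf.comp (g := Function.uncurry f)
        (f := fun v : Fin (n + 2) → X => (v (Fin.last n).castSucc, v (Fin.last (n + 1))))
        ((measurable_pi_apply _).prodMk (measurable_pi_apply _)))
  calc ∫⁻ τ, G (fun i => τ i) * f (τ n) (τ (n + 1)) ∂ζ
      = ∫⁻ v, G (fun i => v i.castSucc) * f (v (Fin.last n).castSucc) (v (Fin.last (n + 1)))
          ∂(prefixLaw K m₀ (n + 1)) := by
        rw [← hζ.2 (n + 1), lintegral_map hH (hprefix (n + 1))]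
        simp
    _ = ∫⁻ v, ∫⁻ y, G v * f (v (Fin.last n)) y ∂(K (v (Fin.last n))) ∂(prefixLaw K m₀ n) := by
        have hsnoc := hH.comp (measurable_finSnoc (X := X) (n + 1))
        simp only [Function.comp_def] at hsnoc
        rw [prefixLaw, lintegral_map hH (measurable_finSnoc _), Measure.lintegral_compProd hsnoc]
        simp [Fin.snoc_castSucc, Fin.snoc_last]
    _ ≤ ∫⁻ v, c * G v ∂(prefixLaw K m₀ n) := by
        refine lintegral_mono fun v => ?_
        rw [lintegral_const_mul _ (hf.of_uncurry_left), mul_comm]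
        gcongr
        exact hc _
    _ = c * ∫⁻ τ, G (fun i => τ i) ∂ζ := by
        rw [lintegral_const_mul _ hG, ← hζ.2 n, lintegral_map hG (hprefix n)]

lemma IsTrajLaw.lintegral_eval_zero (hζ : IsTrajLaw K m₀ ζ) {w : X → ℝ≥0∞} (hw : Measurable w) :
    ∫⁻ τ, w (τ 0) ∂ζ = ∫⁻ x, w x ∂m₀ := by
  have h := congrArg (fun m => ∫⁻ v, w (v 0) ∂m) (hζ.2 0)
  simp only [prefixLaw] at h
  have hw0 : Measurable fun v : Fin (0 + 1) → X => w (v 0) := hw.comp (measurable_pi_apply _)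
  rw [lintegral_map hw0 (measurable_pi_iff.2 fun i => measurable_pi_apply _),
    lintegral_map hw0 (measurable_pi_iff.2 fun i => measurable_id')] at h
  simpa using h

lemma IsTrajLaw.lintegral_prod_le [IsMarkovKernel K] (hζ : IsTrajLaw K m₀ ζ)
    {w : ℕ → X → ℝ≥0∞} (hw : ∀ k, Measurable (w k)) {c : ℕ → ℝ≥0∞} (h0 : ∫⁻ x, w 0 x ∂m₀ ≤ c 0)
    (hc : ∀ k x, ∫⁻ y, w k y ∂(K x) ≤ c k) (t : ℕ) :
    ∫⁻ τ, ∏ k ∈ Finset.range (t + 1), w k (τ k) ∂ζ ≤ ∏ k ∈ Finset.range (t + 1), c k := by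
  induction t with
  | zero => simpa [hζ.lintegral_eval_zero (hw 0)] using h0
  | succ t ih =>
    have h := hζ.lintegral_prefix_mul_le t (G := fun v => ∏ k : Fin (t + 1), w k (v k))
      (Finset.measurable_fun_prod _ fun k _ => (hw k).comp (measurable_pi_apply _))
      (f := fun _ y => w (t + 1) y) ((hw _).comp measurable_snd) (hc (t + 1))
    simp only [fun τ : ℕ → X => Fin.prod_univ_eq_prod_range (fun k => w k (τ k)) (t + 1)] at h
    simp_rw [Finset.prod_range_succ _ (t + 1)]
    rw [mul_comm (∏ k ∈ _, _)]
    exact h.trans (by gcongr)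

end Chain

lemma lintegral_stepK_le {p : Kernel (S × A) S} [IsMarkovKernel p] {π : Kernel S A}
    [IsMarkovKernel π] {w : S × A → ℝ≥0∞} (hw : Measurable w) {c : ℝ≥0∞}
    (hc : ∀ s, ∫⁻ a, w (s, a) ∂(π s) ≤ c) (x : S × A) :
    ∫⁻ y, w y ∂(stepK p π x) ≤ c := by
  rw [stepK, Kernel.lintegral_compProd _ _ _ hw]
  calc _ ≤ ∫⁻ _, c ∂(p x) := lintegral_mono fun s => by simpa using hc s
    _ = c := by simp

lemma lintegral_measureCompProd_le {μ : Measure S} [IsProbabilityMeasure μ] {π : Kernel S A}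
    [IsMarkovKernel π] {w : S × A → ℝ≥0∞} (hw : Measurable w) {c : ℝ≥0∞}
    (hc : ∀ s, ∫⁻ a, w (s, a) ∂(π s) ≤ c) :
    ∫⁻ y, w y ∂(μ ⊗ₘ π) ≤ c := by
  rw [Measure.lintegral_compProd hw]
  calc _ ≤ ∫⁻ _, c ∂μ := lintegral_mono hc
    _ = c := by simp

/-- The second moment of a ratio of densities is positive. -/
lemma lintegral_sq_density_ratio_ne_zero {lam ν νb : Measure A} [IsProbabilityMeasure ν]
    {f fb : A → ℝ} (hf : Measurable f) (hfb : Measurable fb) (hfb_pos : ∀ a, 0 < fb a)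
    (hν : ν = lam.withDensity fun a => ENNReal.ofReal (f a))
    (hνb : νb = lam.withDensity fun a => ENNReal.ofReal (fb a)) :
    ∫⁻ a, ENNReal.ofReal ((f a / fb a) ^ 2) ∂νb ≠ 0 := by
  intro h
  have hm : Measurable fun a => ENNReal.ofReal ((f a / fb a) ^ 2) :=
    ((hf.div hfb).pow_const 2).ennreal_ofReal
  rw [lintegral_eq_zero_iff hm, hνb,
    Filter.EventuallyEq, ae_withDensity_iff hfb.ennreal_ofReal] at h
  refine IsProbabilityMeasure.ne_zero ν ?_
  rw [hν, withDensity_eq_zero_iff hf.ennreal_ofReal.aemeasurable]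
  filter_upwards [h] with a ha
  have h0 := ha (by simpa using hfb_pos a)
  simp only [Pi.zero_apply, ENNReal.ofReal_eq_zero] at h0 ⊢
  have h1 : f a / fb a = 0 := pow_eq_zero_iff two_ne_zero |>.1 (le_antisymm h0 (sq_nonneg _))
  exact ((div_eq_zero_iff.1 h1).resolve_right (hfb_pos a).ne').le

lemma ofReal_mul_ofReal_le (a b : ℝ) :
    ENNReal.ofReal a * ENNReal.ofReal b ≤ ENNReal.ofReal (a * b) := by
  rcases le_total 0 a with ha | ha
  · exact (ENNReal.ofReal_mul ha).ge
  · simp [ENNReal.ofReal_of_nonpos ha]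

/-- Second-moment bound for the weighted log-likelihood objective: under the conditional
moment bounds `χ₁`, `χ₂`, `χ₃` (with `γ χ₁ < 1`),
`E_{τ∼ζ_μ^{π_b,p}}[(∑ₜ γ^t ρ_{π/π_b}(τ_{0:t}) (∑_{l≤t} ‖g(s_l,a_l)‖_q)
  log p̄(s_{t+1}|s_t,a_t))²] ≤ χ₃ χ₂ (1+γχ₁)/((1−γ)(1−γχ₁)³)`. -/
theorem loglik_objective_second_moment
    (p : Kernel (S × A) S) [IsMarkovKernel p]
    (π πb : Kernel S A) [IsMarkovKernel π] [IsMarkovKernel πb]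
    (μ : Measure S) [IsProbabilityMeasure μ]
    (γ : ℝ) (hγ0 : 0 ≤ γ) (hγ1 : γ < 1)
    -- densities of π and π_b w.r.t. a common σ-finite reference measure on A
    (lamA : Measure A) [SigmaFinite lamA]
    (fπ fπb : S → A → ℝ)
    (hfπ : Measurable (Function.uncurry fπ)) (hfπb : Measurable (Function.uncurry fπb))
    (hfπb_pos : ∀ s a, 0 < fπb s a)
    (hπd : ∀ s, π s = lamA.withDensity (fun a => ENNReal.ofReal (fπ s a)))
    (hπbd : ∀ s, πb s = lamA.withDensity (fun a => ENNReal.ofReal (fπb s a)))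
    -- the candidate model `p̄`, with positive density w.r.t. a σ-finite measure on S
    (pbar : Kernel (S × A) S) [IsMarkovKernel pbar]
    (lamS : Measure S) [SigmaFinite lamS]
    (dpb : S × A → S → ℝ) (hdpb : Measurable (Function.uncurry dpb))
    (hdpb_pos : ∀ x s', 0 < dpb x s')
    (hpbard : ∀ x, pbar x = lamS.withDensity (fun s' => ENNReal.ofReal (dpb x s')))
    (d : ℕ) (hd : 1 ≤ d) (q : ℝ≥0∞) [Fact (1 ≤ q)]
    (g : S × A → Fin d → ℝ) (hg : Measurable g)
    (χ₁ χ₂ χ₃ : ℝ) (hγχ₁ : γ * χ₁ < 1)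
    (hχ₁ : ∀ s, ∫⁻ a, ENNReal.ofReal ((fπ s a / fπb s a) ^ 2) ∂(πb s) ≤
      ENNReal.ofReal χ₁)
    (hχ₂ : ∀ s, ∫⁻ a,
        ENNReal.ofReal ((fπ s a / fπb s a) ^ 2 * (lqNorm q (g (s, a))) ^ 2) ∂(πb s) ≤
      ENNReal.ofReal χ₂)
    (hχ₃ : ∀ x : S × A, ∫⁻ s', ENNReal.ofReal ((Real.log (dpb x s')) ^ 2) ∂(p x) ≤
      ENNReal.ofReal χ₃)
    (ζb : Measure (ℕ → S × A)) (hζb : IsTrajLaw (stepK p πb) (μ ⊗ₘ πb) ζb) :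
    ∫⁻ τ, ENNReal.ofReal
        ((∑' t : ℕ, γ ^ t *
            (∏ k ∈ Finset.range (t + 1), fπ (τ k).1 (τ k).2 / fπb (τ k).1 (τ k).2) *
            (∑ l ∈ Finset.range (t + 1), lqNorm q (g (τ l))) *
            Real.log (dpb (τ t) (τ (t + 1)).1)) ^ 2) ∂ζb ≤
      ENNReal.ofReal (χ₃ * χ₂ * (1 + γ * χ₁) / ((1 - γ) * (1 - γ * χ₁) ^ 3)) := by
  obtain ⟨s₀⟩ : Nonempty S := nonempty_of_isProbabilityMeasure μ
  have hχ₁0 : 0 ≤ χ₁ := by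
    by_contra! hneg
    refine lintegral_sq_density_ratio_ne_zero (hfπ.comp measurable_prodMk_left)
      (hfπb.comp measurable_prodMk_left) (hfπb_pos s₀) (hπd s₀) (hπbd s₀) ?_
    simpa [ENNReal.ofReal_of_nonpos hneg.le] using hχ₁ s₀
  let r : S × A → ℝ := fun x => fπ x.1 x.2 / fπb x.1 x.2
  let nrm : S × A → ℝ := fun x => lqNorm q (g x)
  have hrm : Measurable r := hfπ.div hfπb
  have hnm : Measurable nrm := (measurable_lqNorm q).comp hg
  let w : ℕ → ℕ → S × A → ℝ≥0∞ := fun l k x =>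
    ENNReal.ofReal (r x ^ 2 * if k = l then nrm x ^ 2 else 1)
  let c : ℕ → ℕ → ℝ≥0∞ := fun l k => if k = l then ENNReal.ofReal χ₂ else ENNReal.ofReal χ₁
  let L : S × A → S × A → ℝ≥0∞ := fun x y => ENNReal.ofReal (Real.log (dpb x y.1) ^ 2)
  have hwm : ∀ l k, Measurable (w l k) := by
    intro l k
    by_cases h : k = l
    · simpa [w, h] using ((hrm.pow_const 2).mul (hnm.pow_const 2)).ennreal_ofReal
    · simpa [w, h] using (hrm.pow_const 2).ennreal_ofReal
  have hLm : Measurable (Function.uncurry L) := by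
    have : Measurable fun z : (S × A) × (S × A) => Function.uncurry dpb (z.1, z.2.1) :=
      hdpb.comp (measurable_fst.prodMk measurable_snd.fst)
    exact ((Real.measurable_log.comp this).pow_const 2).ennreal_ofReal
  have hwc : ∀ l k s, ∫⁻ a, w l k (s, a) ∂(πb s) ≤ c l k := by
    intro l k s
    by_cases h : k = l
    · simpa [w, c, h] using hχ₂ s
    · simpa [w, c, h] using hχ₁ s
  have hLc : ∀ x, ∫⁻ y, L x y ∂(stepK p πb x) ≤ ENNReal.ofReal χ₃ := by
    intro x
    rw [stepK, Kernel.lintegral_compProd _ _ _ hLm.of_uncurry_left]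
    simpa [L] using hχ₃ x
  have hprod : ∀ t, ∀ l ∈ Finset.range (t + 1), ∏ k ∈ Finset.range (t + 1), c l k =
      ENNReal.ofReal χ₂ * ENNReal.ofReal χ₁ ^ t := by
    intro t l hl
    rw [← Finset.mul_prod_erase _ _ hl, Finset.prod_congr rfl
      (g := fun _ => ENNReal.ofReal χ₁) fun k hk => by simp [c, Finset.ne_of_mem_erase hk]]
    simp [c, Finset.card_erase_of_mem hl]
  have hGm : ∀ t l, Measurable fun v : Fin (t + 1) → S × A => ∏ k : Fin (t + 1), w l k (v k) :=
    fun t l => Finset.measurable_fun_prod _ fun k _ => (hwm l k).comp (measurable_pi_apply _)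
  have hterm : ∀ t, ∀ l ∈ Finset.range (t + 1),
      ∫⁻ τ, (∏ k ∈ Finset.range (t + 1), w l k (τ k)) * L (τ t) (τ (t + 1)) ∂ζb ≤
        ENNReal.ofReal χ₃ * (ENNReal.ofReal χ₂ * ENNReal.ofReal χ₁ ^ t) := by
    intro t l hl
    have h := hζb.lintegral_prefix_mul_le t (hGm t l) hLm hLc
    simp only [fun τ : ℕ → S × A => Fin.prod_univ_eq_prod_range (fun k => w l k (τ k)) (t + 1)]
      at h
    refine h.trans ?_
    gcongr
    rw [← hprod t l hl]
    exact hζb.lintegral_prod_le (hwm l) (lintegral_measureCompProd_le (hwm l 0) (hwc l 0))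
      (fun k => lintegral_stepK_le (hwm l k) (hwc l k)) t
  have hmeas : ∀ t l, Measurable fun τ : ℕ → S × A =>
      (∏ k ∈ Finset.range (t + 1), w l k (τ k)) * L (τ t) (τ (t + 1)) := by
    intro t l
    refine (Finset.measurable_fun_prod _ fun k _ =>
      (hwm l k).comp (measurable_pi_apply _)).mul ?_
    exact hLm.comp (g := Function.uncurry L) (f := fun τ : ℕ → S × A => (τ t, τ (t + 1)))
      ((measurable_pi_apply t).prodMk (measurable_pi_apply (t + 1)))
  let y : (ℕ → S × A) → ℕ → ℝ := fun τ t => (∏ k ∈ Finset.range (t + 1), r (τ k)) *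
    (∑ l ∈ Finset.range (t + 1), nrm (τ l)) * Real.log (dpb (τ t) (τ (t + 1)).1)
  have hy : ∀ τ t, ENNReal.ofReal (γ ^ t * y τ t ^ 2) ≤ ENNReal.ofReal (γ ^ t * (t + 1)) *
      ∑ l ∈ Finset.range (t + 1),
        (∏ k ∈ Finset.range (t + 1), w l k (τ k)) * L (τ t) (τ (t + 1)) := by
    intro τ t
    have hcs := sq_sum_le_card_mul_sum_sq (s := Finset.range (t + 1)) (f := fun l => nrm (τ l))
    rw [Finset.card_range] at hcs
    push_cast at hcs
    have hreal : γ ^ t * y τ t ^ 2 ≤ (γ ^ t * (t + 1)) * ∑ l ∈ Finset.range (t + 1),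
        (∏ k ∈ Finset.range (t + 1), r (τ k) ^ 2 * if k = l then nrm (τ k) ^ 2 else 1) *
          Real.log (dpb (τ t) (τ (t + 1)).1) ^ 2 := by
      have heq : ∑ l ∈ Finset.range (t + 1),
          (∏ k ∈ Finset.range (t + 1), r (τ k) ^ 2 * if k = l then nrm (τ k) ^ 2 else 1) *
            Real.log (dpb (τ t) (τ (t + 1)).1) ^ 2 =
          (∏ k ∈ Finset.range (t + 1), r (τ k)) ^ 2 *
            Real.log (dpb (τ t) (τ (t + 1)).1) ^ 2 *
            ∑ l ∈ Finset.range (t + 1), nrm (τ l) ^ 2 := by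
        rw [Finset.mul_sum]
        refine Finset.sum_congr rfl fun l hl => ?_
        rw [Finset.prod_mul_distrib, Finset.prod_ite_eq', if_pos hl, Finset.prod_pow]
        ring
      rw [heq]
      calc γ ^ t * y τ t ^ 2 = (γ ^ t * ((∏ k ∈ Finset.range (t + 1), r (τ k)) ^ 2 *
            Real.log (dpb (τ t) (τ (t + 1)).1) ^ 2)) *
            (∑ l ∈ Finset.range (t + 1), nrm (τ l)) ^ 2 := by simp only [y]; ring
        _ ≤ _ := mul_le_mul_of_nonneg_left hcs (by positivity)
        _ = _ := by ring
    have hnn : ∀ l k, 0 ≤ r (τ k) ^ 2 * if k = l then nrm (τ k) ^ 2 else 1 := fun l k => by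
      split_ifs <;> positivity
    refine (ENNReal.ofReal_le_ofReal hreal).trans_eq ?_
    rw [ENNReal.ofReal_mul (by positivity), ENNReal.ofReal_sum_of_nonneg fun l _ =>
      mul_nonneg (Finset.prod_nonneg fun k _ => hnn l k) (sq_nonneg _)]
    congr 1
    refine Finset.sum_congr rfl fun l _ => ?_
    rw [ENNReal.ofReal_mul (Finset.prod_nonneg fun k _ => hnn l k),
      ENNReal.ofReal_prod_of_nonneg fun k _ => hnn l k]
  have hx0 : 0 ≤ γ * χ₁ := mul_nonneg hγ0 hχ₁0
  have hsum := hasSum_succ_sq_mul_geometric hx0 hγχ₁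
  calc _ ≤ ∫⁻ τ, ENNReal.ofReal (1 - γ)⁻¹ * ∑' t : ℕ, ENNReal.ofReal (γ ^ t * (t + 1)) *
        ∑ l ∈ Finset.range (t + 1),
          (∏ k ∈ Finset.range (t + 1), w l k (τ k)) * L (τ t) (τ (t + 1)) ∂ζb := by
        refine lintegral_mono fun τ => ?_
        have h := ofReal_tsum_geometric_mul_sq_le hγ0 hγ1 (y τ)
        simp only [y, ← mul_assoc] at h
        refine h.trans ?_
        gcongr with t
        simpa only [y, ← mul_assoc] using hy τ t
    _ = ENNReal.ofReal (1 - γ)⁻¹ * ∑' t : ℕ, ENNReal.ofReal (γ ^ t * (t + 1)) *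
        ∑ l ∈ Finset.range (t + 1),
          ∫⁻ τ, (∏ k ∈ Finset.range (t + 1), w l k (τ k)) * L (τ t) (τ (t + 1)) ∂ζb := by
        have hs : ∀ t : ℕ, Measurable fun τ : ℕ → S × A => ∑ l ∈ Finset.range (t + 1),
            (∏ k ∈ Finset.range (t + 1), w l k (τ k)) * L (τ t) (τ (t + 1)) :=
          fun t => Finset.measurable_fun_sum _ fun l _ => hmeas t l
        rw [lintegral_const_mul _ (Measurable.tsum fun t => (hs t).const_mul _),
          lintegral_tsum fun t => ((hs t).const_mul _).aemeasurable]
        congr 2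
        ext t
        rw [lintegral_const_mul _ (hs t), lintegral_finsetSum _ fun l _ => hmeas t l]
    _ ≤ ENNReal.ofReal (1 - γ)⁻¹ * ∑' t : ℕ, ENNReal.ofReal (γ ^ t * (t + 1)) *
        ∑ l ∈ Finset.range (t + 1),
          ENNReal.ofReal χ₃ * (ENNReal.ofReal χ₂ * ENNReal.ofReal χ₁ ^ t) := by
        gcongr with t l hl
        exact hterm t l hl
    _ = ENNReal.ofReal (1 - γ)⁻¹ * ENNReal.ofReal ((1 + γ * χ₁) / (1 - γ * χ₁) ^ 3) *
        (ENNReal.ofReal χ₃ * ENNReal.ofReal χ₂) := by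
        rw [← hsum.tsum_eq, ENNReal.ofReal_tsum_of_nonneg (fun t => by positivity) hsum.summable,
          mul_assoc, ← ENNReal.tsum_mul_right]
        congr 2
        ext t
        have hcast : ((t : ℝ) + 1) ^ 2 * (γ * χ₁) ^ t = γ ^ t * (t + 1) * ((t + 1) * χ₁ ^ t) := by
          ring
        rw [hcast, ENNReal.ofReal_mul (p := γ ^ t * (t + 1)) (by positivity),
          ENNReal.ofReal_mul (p := (t : ℝ) + 1) (by positivity), ENNReal.ofReal_pow hχ₁0,
          ENNReal.ofReal_add (by positivity) zero_le_one]
        simp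
        ring
    _ ≤ ENNReal.ofReal ((1 - γ)⁻¹ * ((1 + γ * χ₁) / (1 - γ * χ₁) ^ 3)) *
        ENNReal.ofReal (χ₃ * χ₂) := by
        rw [ENNReal.ofReal_mul (inv_nonneg.2 (by linarith))]
        gcongr
        exact ofReal_mul_ofReal_le _ _
    _ = _ := by
        rw [← ENNReal.ofReal_mul]
        · congr 1
          have h1 : 1 - γ ≠ 0 := by linarith
          have h2 : 1 - γ * χ₁ ≠ 0 := by linarith
          field_simp
        · have h1 : 0 < 1 - γ := by linarith
          have h2 : 0 < 1 - γ * χ₁ := by linarith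
          positivity

end
end
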